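/- Let L > 0 and let v = (v₁,v₂) : ℝ² → ℝ² be a smooth L-periodic divergence-free vector field. Then ∫_{[0,L]²} (∂_{yy} Δ v₁)(Δ² v₁) dx + ∫_{[0,L]²} (∂_{xx} Δ v₂)(Δ² v₂) dx = ∫_{[0,L]²} [(∂_{yy} Δ v₁)² + (∂_{yy} Δ v₂)² + (∂_{xx} Δ v₂)² + (∂_{xx} Δ v₁)²] dx ≥ (1/2) ∫_{[0,L]²} (|Δ² v₁|² + |Δ² v₂|²) dx. -/

import Mathlib

open MeasureTheory Real Filter

noncomputable def pdX (f : ℝ × ℝ → ℝ) : ℝ × ℝ → ℝ := fun p => fderiv ℝ f p (1, 0)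

noncomputable def pdY (f : ℝ × ℝ → ℝ) : ℝ × ℝ → ℝ := fun p => fderiv ℝ f p (0, 1)

noncomputable def lap (f : ℝ × ℝ → ℝ) : ℝ × ℝ → ℝ := fun p => pdX (pdX f) p + pdY (pdY f) p

/-- `f` is `L`-periodic in each coordinate. -/
def IsPeriodicL (L : ℝ) (f : ℝ × ℝ → ℝ) : Prop :=
  (∀ p : ℝ × ℝ, f (p.1 + L, p.2) = f p) ∧ (∀ p : ℝ × ℝ, f (p.1, p.2 + L) = f p)

/-- The fundamental square `[0,L] × [0,L]`. -/
def Torus (L : ℝ) : Set (ℝ × ℝ) := Set.Icc (0:ℝ) L ×ˢ Set.Icc (0:ℝ) L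

theorem contDiff_pdX {f : ℝ × ℝ → ℝ} (hf : ContDiff ℝ (⊤ : ℕ∞) f) :
    ContDiff ℝ (⊤ : ℕ∞) (pdX f) :=
  (hf.fderiv_right (m := (⊤ : ℕ∞)) (by simp)).clm_apply contDiff_const

theorem contDiff_pdY {f : ℝ × ℝ → ℝ} (hf : ContDiff ℝ (⊤ : ℕ∞) f) :
    ContDiff ℝ (⊤ : ℕ∞) (pdY f) :=
  (hf.fderiv_right (m := (⊤ : ℕ∞)) (by simp)).clm_apply contDiff_const

theorem contDiff_lap {f : ℝ × ℝ → ℝ} (hf : ContDiff ℝ (⊤ : ℕ∞) f) :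
    ContDiff ℝ (⊤ : ℕ∞) (lap f) :=
  (contDiff_pdX (contDiff_pdX hf)).add (contDiff_pdY (contDiff_pdY hf))

theorem IsPeriodicL.fderiv_apply {L : ℝ} {f : ℝ × ℝ → ℝ} (hf : IsPeriodicL L f)
    (w : ℝ × ℝ) : IsPeriodicL L (fun p => fderiv ℝ f p w) := by
  have key (c : ℝ × ℝ) (hc : ∀ p, f (p + c) = f p) (p : ℝ × ℝ) :
      fderiv ℝ f (p + c) w = fderiv ℝ f p w := by
    rw [← fderiv_comp_add_right, funext hc]
  constructor
  · intro p
    have h := key (L, 0) (fun p => by simpa [Prod.add_def] using hf.1 p) p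
    simpa [Prod.add_def] using h
  · intro p
    have h := key (0, L) (fun p => by simpa [Prod.add_def] using hf.2 p) p
    simpa [Prod.add_def] using h

theorem IsPeriodicL.pdX {L : ℝ} {f : ℝ × ℝ → ℝ} (hf : IsPeriodicL L f) :
    IsPeriodicL L (pdX f) :=
  hf.fderiv_apply (1, 0)

theorem IsPeriodicL.pdY {L : ℝ} {f : ℝ × ℝ → ℝ} (hf : IsPeriodicL L f) :
    IsPeriodicL L (pdY f) :=
  hf.fderiv_apply (0, 1)

theorem IsPeriodicL.lap {L : ℝ} {f : ℝ × ℝ → ℝ} (hf : IsPeriodicL L f) :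
    IsPeriodicL L (lap f) :=
  ⟨fun p => congrArg₂ (· + ·) (hf.pdX.pdX.1 p) (hf.pdY.pdY.1 p),
    fun p => congrArg₂ (· + ·) (hf.pdX.pdX.2 p) (hf.pdY.pdY.2 p)⟩

theorem IsPeriodicL.mul {L : ℝ} {f g : ℝ × ℝ → ℝ} (hf : IsPeriodicL L f)
    (hg : IsPeriodicL L g) : IsPeriodicL L (fun p => f p * g p) :=
  ⟨fun p => congrArg₂ (· * ·) (hf.1 p) (hg.1 p),
    fun p => congrArg₂ (· * ·) (hf.2 p) (hg.2 p)⟩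

theorem pdX_pdY_comm {f : ℝ × ℝ → ℝ} (hf : ContDiff ℝ (⊤ : ℕ∞) f) :
    pdX (pdY f) = pdY (pdX f) := by
  funext p
  have hd : DifferentiableAt ℝ (fderiv ℝ f) p :=
    (hf.fderiv_right (m := (⊤ : ℕ∞)) (by simp)).differentiable (by simp) p
  have hs : IsSymmSndFDerivAt ℝ f p :=
    (contDiff_infty.1 hf 2).contDiffAt.isSymmSndFDerivAt (by simp)
  have e (u w : ℝ × ℝ) :
      fderiv ℝ (fun q => fderiv ℝ f q u) p w = fderiv ℝ (fderiv ℝ f) p w u := by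
    rw [fderiv_clm_apply hd (differentiableAt_const u)]
    simp
  change fderiv ℝ (fun q => fderiv ℝ f q (0, 1)) p (1, 0) =
    fderiv ℝ (fun q => fderiv ℝ f q (1, 0)) p (0, 1)
  rw [e, e]
  exact hs (1, 0) (0, 1)

theorem pdX_add {f g : ℝ × ℝ → ℝ} (hf : ContDiff ℝ (⊤ : ℕ∞) f)
    (hg : ContDiff ℝ (⊤ : ℕ∞) g) :
    pdX (fun p => f p + g p) = fun p => pdX f p + pdX g p := by
  funext p
  unfold pdX
  rw [fderiv_fun_add (hf.differentiable (by simp) p) (hg.differentiable (by simp) p)]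
  rfl

theorem pdY_add {f g : ℝ × ℝ → ℝ} (hf : ContDiff ℝ (⊤ : ℕ∞) f)
    (hg : ContDiff ℝ (⊤ : ℕ∞) g) :
    pdY (fun p => f p + g p) = fun p => pdY f p + pdY g p := by
  funext p
  unfold pdY
  rw [fderiv_fun_add (hf.differentiable (by simp) p) (hg.differentiable (by simp) p)]
  rfl

theorem pdX_neg (f : ℝ × ℝ → ℝ) : pdX (fun p => -f p) = fun p => -pdX f p := by
  funext p
  simp [pdX]

theorem pdY_neg (f : ℝ × ℝ → ℝ) : pdY (fun p => -f p) = fun p => -pdY f p := by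
  funext p
  simp [pdY]

theorem pdX_mul {f g : ℝ × ℝ → ℝ} (hf : ContDiff ℝ (⊤ : ℕ∞) f)
    (hg : ContDiff ℝ (⊤ : ℕ∞) g) (p : ℝ × ℝ) :
    pdX (fun p => f p * g p) p = f p * pdX g p + g p * pdX f p := by
  unfold pdX
  rw [fderiv_fun_mul (hf.differentiable (by simp) p) (hg.differentiable (by simp) p)]
  rfl

theorem pdY_mul {f g : ℝ × ℝ → ℝ} (hf : ContDiff ℝ (⊤ : ℕ∞) f)
    (hg : ContDiff ℝ (⊤ : ℕ∞) g) (p : ℝ × ℝ) :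
    pdY (fun p => f p * g p) p = f p * pdY g p + g p * pdY f p := by
  unfold pdY
  rw [fderiv_fun_mul (hf.differentiable (by simp) p) (hg.differentiable (by simp) p)]
  rfl

theorem lap_pdX {f : ℝ × ℝ → ℝ} (hf : ContDiff ℝ (⊤ : ℕ∞) f) :
    lap (pdX f) = pdX (lap f) := by
  have h : pdX (lap f) = fun p => pdX (pdX (pdX f)) p + pdX (pdY (pdY f)) p :=
    pdX_add (contDiff_pdX (contDiff_pdX hf)) (contDiff_pdY (contDiff_pdY hf))
  rw [h, pdX_pdY_comm (contDiff_pdY hf), pdX_pdY_comm hf]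
  rfl

theorem lap_pdY {f : ℝ × ℝ → ℝ} (hf : ContDiff ℝ (⊤ : ℕ∞) f) :
    lap (pdY f) = pdY (lap f) := by
  have h : pdY (lap f) = fun p => pdY (pdX (pdX f)) p + pdY (pdY (pdY f)) p :=
    pdY_add (contDiff_pdX (contDiff_pdX hf)) (contDiff_pdY (contDiff_pdY hf))
  rw [h, ← pdX_pdY_comm (contDiff_pdX hf), ← pdX_pdY_comm hf]
  rfl

theorem lap_neg (f : ℝ × ℝ → ℝ) : lap (fun p => -f p) = fun p => -lap f p := by
  funext p
  simp only [lap, pdX_neg, pdY_neg]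
  ring

/-- The Laplacian preserves the divergence-free condition. -/
theorem pdX_lap_eq_neg_pdY_lap {f g : ℝ × ℝ → ℝ} (hf : ContDiff ℝ (⊤ : ℕ∞) f)
    (hg : ContDiff ℝ (⊤ : ℕ∞) g) (h : ∀ p, pdX f p + pdY g p = 0) :
    pdX (lap f) = fun p => -pdY (lap g) p := by
  have h' : pdX f = fun p => -pdY g p := funext fun p => eq_neg_of_add_eq_zero_left (h p)
  rw [← lap_pdX hf, h', lap_neg, lap_pdY hg]

theorem Torus_eq_Icc (L : ℝ) : Torus L = Set.Icc ((0, 0) : ℝ × ℝ) (L, L) :=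
  Set.Icc_prod_Icc 0 L 0 L

theorem integrableOn_torus (L : ℝ) {f : ℝ × ℝ → ℝ} (hf : Continuous f) :
    IntegrableOn f (Torus L) :=
  hf.continuousOn.integrableOn_compact (isCompact_Icc.prod isCompact_Icc)

/-- A periodic divergence integrates to zero over the fundamental square. -/
theorem integral_torus_div_eq_zero {L : ℝ} (hL : 0 ≤ L) {f g : ℝ × ℝ → ℝ}
    (hf : ContDiff ℝ (⊤ : ℕ∞) f) (hg : ContDiff ℝ (⊤ : ℕ∞) g)
    (hpf : IsPeriodicL L f) (hpg : IsPeriodicL L g) :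
    ∫ p in Torus L, (pdX f p + pdY g p) = 0 := by
  have hi := integrableOn_torus L ((contDiff_pdX hf).add (contDiff_pdY hg)).continuous
  rw [Torus_eq_Icc] at hi ⊢
  have h := integral_divergence_prod_Icc_of_hasFDerivAt_of_le f g (fderiv ℝ f) (fderiv ℝ g)
    (0, 0) (L, L) ⟨hL, hL⟩ hf.continuous.continuousOn hg.continuous.continuousOn
    (fun p _ => (hf.differentiable (by simp) p).hasFDerivAt)
    (fun p _ => (hg.differentiable (by simp) p).hasFDerivAt) hi
  have hx (y : ℝ) : f (L, y) = f (0, y) := by simpa using hpf.1 (0, y)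
  have hy (x : ℝ) : g (x, L) = g (x, 0) := by simpa using hpg.2 (x, 0)
  simpa [hx, hy, pdX, pdY] using h

/-- Integrating by parts twice moves the mixed derivatives onto one another. -/
theorem integral_pdX_pdX_mul_pdY_pdY {L : ℝ} (hL : 0 ≤ L) {f : ℝ × ℝ → ℝ}
    (hf : ContDiff ℝ (⊤ : ℕ∞) f) (hpf : IsPeriodicL L f) :
    ∫ p in Torus L, pdX (pdX f) p * pdY (pdY f) p = ∫ p in Torus L, (pdY (pdX f) p) ^ 2 := by
  have hx := contDiff_pdX hf
  have hy := contDiff_pdY hf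
  have hxx := contDiff_pdX hx
  have hyy := contDiff_pdY hy
  have hyx := contDiff_pdY hx
  have h := integral_torus_div_eq_zero hL (hx.mul hyy) (hx.mul hyx).neg
    (hpf.pdX.mul hpf.pdY.pdY)
    ⟨fun p => congrArg Neg.neg ((hpf.pdX.mul hpf.pdX.pdY).1 p),
      fun p => congrArg Neg.neg ((hpf.pdX.mul hpf.pdX.pdY).2 p)⟩
  rw [← sub_eq_zero, ← integral_sub (integrableOn_torus L (hxx.mul hyy).continuous)
    (integrableOn_torus L (hyx.pow 2).continuous), ← h]
  congr 1
  funext p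
  simp only [pdY_neg, pdX_mul hx hyy, pdY_mul hx hyx]
  rw [pdX_pdY_comm hy, pdX_pdY_comm hf]
  ring

/-- Fourth-order anisotropic coercivity (6.11): for a smooth `L`-periodic
divergence-free vector field `v = (v₁,v₂)`,
`∫ (∂_{yy}Δv₁)(Δ²v₁) + ∫ (∂_{xx}Δv₂)(Δ²v₂)
  = ∫ [(∂_{yy}Δv₁)² + (∂_{yy}Δv₂)² + (∂_{xx}Δv₂)² + (∂_{xx}Δv₁)²]
  ≥ (1/2) ∫ (|Δ²v₁|² + |Δ²v₂|²)`. -/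
theorem aniso_coercivity_fourth_order (L : ℝ) (hL : 0 < L)
    (v₁ v₂ : ℝ × ℝ → ℝ)
    (hsv₁ : ContDiff ℝ (⊤ : ℕ∞) v₁) (hsv₂ : ContDiff ℝ (⊤ : ℕ∞) v₂)
    (hpv₁ : IsPeriodicL L v₁) (hpv₂ : IsPeriodicL L v₂)
    (hdiv : ∀ p : ℝ × ℝ, pdX v₁ p + pdY v₂ p = 0) :
    ((∫ p in Torus L, (pdY (pdY (lap v₁)) p) * (lap (lap v₁) p)) +
        (∫ p in Torus L, (pdX (pdX (lap v₂)) p) * (lap (lap v₂) p)) =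
      ∫ p in Torus L,
        ((pdY (pdY (lap v₁)) p)^2 + (pdY (pdY (lap v₂)) p)^2 +
          (pdX (pdX (lap v₂)) p)^2 + (pdX (pdX (lap v₁)) p)^2)) ∧
    (1/2) * (∫ p in Torus L, ((lap (lap v₁) p)^2 + (lap (lap v₂) p)^2)) ≤
      ∫ p in Torus L,
        ((pdY (pdY (lap v₁)) p)^2 + (pdY (pdY (lap v₂)) p)^2 +
          (pdX (pdX (lap v₂)) p)^2 + (pdX (pdX (lap v₁)) p)^2) := by
  have hw₁ := contDiff_lap hsv₁
  have hw₂ := contDiff_lap hsv₂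
  have hdw := pdX_lap_eq_neg_pdY_lap hsv₁ hsv₂ hdiv
  have i₁ := integral_pdX_pdX_mul_pdY_pdY hL.le hw₁ hpv₁.lap
  have i₂ := integral_pdX_pdX_mul_pdY_pdY hL.le hw₂ hpv₂.lap
  have e₁ (p : ℝ × ℝ) : (pdY (pdX (lap v₁)) p) ^ 2 = (pdY (pdY (lap v₂)) p) ^ 2 := by
    rw [hdw, pdY_neg, neg_sq]
  have e₂ (p : ℝ × ℝ) : (pdY (pdX (lap v₂)) p) ^ 2 = (pdX (pdX (lap v₁)) p) ^ 2 := by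
    rw [← pdX_pdY_comm hw₂, hdw, pdX_neg, neg_sq]
  simp only [e₁] at i₁
  simp only [e₂] at i₂
  have cxx₁ := (contDiff_pdX (contDiff_pdX hw₁)).continuous
  have cyy₁ := (contDiff_pdY (contDiff_pdY hw₁)).continuous
  have cxx₂ := (contDiff_pdX (contDiff_pdX hw₂)).continuous
  have cyy₂ := (contDiff_pdY (contDiff_pdY hw₂)).continuous
  have l₁ (p : ℝ × ℝ) : lap (lap v₁) p = pdX (pdX (lap v₁)) p + pdY (pdY (lap v₁)) p := rfl
  have l₂ (p : ℝ × ℝ) : lap (lap v₂) p = pdX (pdX (lap v₂)) p + pdY (pdY (lap v₂)) p := rfl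
  simp only [l₁, l₂]
  generalize pdX (pdX (lap v₁)) = a₁ at *
  generalize pdY (pdY (lap v₁)) = b₁ at *
  generalize pdX (pdX (lap v₂)) = a₂ at *
  generalize pdY (pdY (lap v₂)) = b₂ at *
  have I {f : ℝ × ℝ → ℝ} (hf : Continuous f) : IntegrableOn f (Torus L) :=
    integrableOn_torus L hf
  constructor
  · have s₁ : ∫ p in Torus L, b₁ p * (a₁ p + b₁ p) =
        (∫ p in Torus L, a₁ p * b₁ p) + ∫ p in Torus L, b₁ p ^ 2 := by
      rw [← integral_add (I (by fun_prop)) (I (by fun_prop))]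
      congr 1
      funext p
      ring
    have s₂ : ∫ p in Torus L, a₂ p * (a₂ p + b₂ p) =
        (∫ p in Torus L, a₂ p * b₂ p) + ∫ p in Torus L, a₂ p ^ 2 := by
      rw [← integral_add (I (by fun_prop)) (I (by fun_prop))]
      congr 1
      funext p
      ring
    rw [s₁, s₂, i₁, i₂, integral_add (I (by fun_prop)) (I (by fun_prop)),
      integral_add (I (by fun_prop)) (I (by fun_prop)),
      integral_add (I (by fun_prop)) (I (by fun_prop))]
    ring
  · rw [← integral_const_mul]
    refine integral_mono (I (by fun_prop)) (I (by fun_prop)) fun p => ?_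
    change 1 / 2 * ((a₁ p + b₁ p) ^ 2 + (a₂ p + b₂ p) ^ 2) ≤
      b₁ p ^ 2 + b₂ p ^ 2 + a₂ p ^ 2 + a₁ p ^ 2
    nlinarith [sq_nonneg (a₁ p - b₁ p), sq_nonneg (a₂ p - b₂ p)]
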